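/- arXiv:1002.1008 — 2 statements merged into one kernel-verified Lean document; each statement's English description precedes it below -/
import Mathlib

section
/- Let f ∈ V_10. If the transvectants (f,f)_10, (f,f)_8 and (f,f)_6 all vanish, then f has a root of multiplicity at least 8. -/
open MvPolynomial

/-- The `k`-th transvectant of two binary forms `f` of degree `n` and `g` of degree `m`. -/
noncomputable def transv (n m k : ℕ)
    (f g : MvPolynomial (Fin 2) ℂ) : MvPolynomial (Fin 2) ℂ :=
  ((((n - k).factorial * (m - k).factorial : ℕ) : ℂ) / ((n.factorial * m.factorial : ℕ) : ℂ)) •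
    ∑ i ∈ Finset.range (k + 1),
      ((-1 : ℂ) ^ i * (k.choose i : ℂ)) •
        ((fun p => pderiv (0 : Fin 2) p)^[k - i] ((fun p => pderiv (1 : Fin 2) p)^[i] f) *
         (fun p => pderiv (0 : Fin 2) p)^[i] ((fun p => pderiv (1 : Fin 2) p)^[k - i] g))

/-- A binary form `f` has a root of multiplicity (at least) `r` if some nonzero linear
form `ℓ = αx + βy` satisfies `ℓ^r ∣ f`. -/
def HasRootOfMult (r : ℕ) (f : MvPolynomial (Fin 2) ℂ) : Prop :=
  ∃ a b : ℂ, (a ≠ 0 ∨ b ≠ 0) ∧ (C a * X 0 + C b * X 1) ^ r ∣ f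

/-- The binary form of degree `n` whose coefficients, normalised by binomials, are `a 0, …, a n`. -/
noncomputable def binaryForm (n : ℕ) (a : ℕ → ℂ) : MvPolynomial (Fin 2) ℂ :=
  ∑ j ∈ Finset.range (n + 1), C ((n.choose j : ℂ) * a j) * X 0 ^ (n - j) * X 1 ^ j

lemma C_ofNat (n : ℕ) [n.AtLeastTwo] :
    (C (ofNat(n) : ℂ) : MvPolynomial (Fin 2) ℂ) = ofNat(n) :=
  map_ofNat C n

lemma exists_eq_binaryForm {n : ℕ} {f : MvPolynomial (Fin 2) ℂ} (hf : f.IsHomogeneous n) :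
    ∃ a, f = binaryForm n a := by
  classical
  let m : ℕ → Fin 2 →₀ ℕ := fun j => Finsupp.single 0 (n - j) + Finsupp.single 1 j
  have hm : ∀ j b, C b * X 0 ^ (n - j) * X 1 ^ j = (monomial (m j) b : MvPolynomial (Fin 2) ℂ) := by
    intro j b
    rw [X_pow_eq_monomial, X_pow_eq_monomial, C_mul_monomial, monomial_mul]
    simp [m]
  refine ⟨fun j => coeff (m j) f / (n.choose j : ℂ), ?_⟩
  ext d
  simp only [binaryForm, hm, coeff_sum, coeff_monomial]
  by_cases hd : d 0 + d 1 = n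
  · have hdm : d = m (d 1) := by
      ext i
      fin_cases i <;> simp [m]
      omega
    rw [Finset.sum_eq_single (d 1)]
    · rw [if_pos hdm.symm, ← hdm, mul_div_cancel₀]
      exact_mod_cast (Nat.choose_pos (by omega)).ne'
    · intro j _ hj
      refine if_neg fun h => hj ?_
      rw [← h]
      simp [m]
    · intro h
      exact absurd (Finset.mem_range.2 (by omega)) h
  · rw [Finset.sum_eq_zero]
    · by_contra h
      have := hf h
      rw [Finsupp.weight_apply, Finsupp.sum_fintype _ _ (by simp)] at this
      simp at this
      exact hd this
    · intro j hj
      refine if_neg fun h => hd ?_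
      rw [← h]
      have := Finset.mem_range.1 hj
      simp [m]
      omega

lemma pderiv_zero_binaryForm (n : ℕ) (a : ℕ → ℂ) :
    pderiv 0 (binaryForm (n + 1) a) = C ((n + 1 : ℕ) : ℂ) * binaryForm n a := by
  rw [binaryForm, Finset.sum_range_succ, map_add, map_sum, binaryForm, Finset.mul_sum]
  have h10 : pderiv (0 : Fin 2) (X 1 : MvPolynomial (Fin 2) ℂ) = 0 := pderiv_X_of_ne (by decide)
  have hlast : pderiv (0 : Fin 2) (C (((n + 1).choose (n + 1) : ℂ) * a (n + 1)) *
      X 0 ^ (n + 1 - (n + 1)) * X 1 ^ (n + 1) : MvPolynomial (Fin 2) ℂ) = 0 := by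
    simp [Derivation.leibniz, Derivation.leibniz_pow, h10]
  rw [hlast, add_zero]
  refine Finset.sum_congr rfl fun j hj => ?_
  have hj' := Finset.mem_range_succ_iff.1 hj
  have hc : (((n + 1).choose j : ℕ) : ℂ) * ((n + 1 - j : ℕ) : ℂ) =
      (n + 1 : ℕ) * (n.choose j : ℕ) := by
    have h := Nat.choose_mul_succ_eq n j
    rw [← Nat.cast_mul, ← Nat.cast_mul, ← h, mul_comm]
  have hs : n + 1 - j - 1 = n - j := by omega
  simp only [Derivation.leibniz, Derivation.leibniz_pow, h10, pderiv_C, pderiv_X_self, smul_eq_mul,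
    mul_zero, smul_zero, zero_add, add_zero, hs, mul_one, nsmul_eq_mul]
  rw [← map_natCast (C : ℂ →+* MvPolynomial (Fin 2) ℂ) (n + 1 - j)]
  have : (C ((n + 1 : ℕ) : ℂ) * (C ((n.choose j : ℂ) * a j) * X 0 ^ (n - j) * X 1 ^ j) :
      MvPolynomial (Fin 2) ℂ) = C ((n + 1 : ℕ) * (n.choose j : ℕ) * a j) * X 0 ^ (n - j) * X 1 ^ j := by
    simp only [C_mul]; ring
  rw [this, ← hc]
  simp only [C_mul]
  ring

lemma pderiv_one_binaryForm (n : ℕ) (a : ℕ → ℂ) :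
    pderiv 1 (binaryForm (n + 1) a) =
      C ((n + 1 : ℕ) : ℂ) * binaryForm n (fun j => a (j + 1)) := by
  rw [binaryForm, Finset.sum_range_succ', map_add, map_sum, binaryForm, Finset.mul_sum]
  have h01 : pderiv (1 : Fin 2) (X 0 : MvPolynomial (Fin 2) ℂ) = 0 := pderiv_X_of_ne (by decide)
  have hlast : pderiv (1 : Fin 2) (C (((n + 1).choose 0 : ℂ) * a 0) *
      X 0 ^ (n + 1 - 0) * X 1 ^ 0 : MvPolynomial (Fin 2) ℂ) = 0 := by
    simp [Derivation.leibniz, Derivation.leibniz_pow, h01]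
  rw [hlast, add_zero]
  refine Finset.sum_congr rfl fun j hj => ?_
  have hc : (((n + 1).choose (j + 1) : ℕ) : ℂ) * ((j + 1 : ℕ) : ℂ) =
      (n + 1 : ℕ) * (n.choose j : ℕ) := by
    rw [← Nat.cast_mul, ← Nat.cast_mul, Nat.add_one_mul_choose_eq]
  have hs : n + 1 - (j + 1) = n - j := by omega
  simp only [Derivation.leibniz, Derivation.leibniz_pow, h01, pderiv_C, pderiv_X_self, smul_eq_mul,
    mul_zero, smul_zero, add_zero, hs, mul_one, nsmul_eq_mul, Nat.add_sub_cancel]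
  rw [← map_natCast (C : ℂ →+* MvPolynomial (Fin 2) ℂ) (j + 1)]
  have : (C ((n + 1 : ℕ) : ℂ) * (C ((n.choose j : ℂ) * a (j + 1)) * X 0 ^ (n - j) * X 1 ^ j) :
      MvPolynomial (Fin 2) ℂ) =
      C ((n + 1 : ℕ) * (n.choose j : ℕ) * a (j + 1)) * X 0 ^ (n - j) * X 1 ^ j := by
    simp only [C_mul]; ring
  rw [this, ← hc]
  simp only [C_mul]
  ring

lemma iterate_pderiv_zero_C_mul_binaryForm (n p : ℕ) (c : ℂ) (a : ℕ → ℂ) :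
    (fun q => pderiv (0 : Fin 2) q)^[p] (C c * binaryForm (n + p) a) =
      C (c * (n + p).descFactorial p) * binaryForm n a := by
  induction p generalizing c with
  | zero => simp
  | succ p ih =>
    rw [Function.iterate_succ_apply, pderiv_C_mul, ← add_assoc, pderiv_zero_binaryForm,
      ← mul_assoc, ← C_mul, ih, Nat.succ_descFactorial_succ]
    push_cast
    ring_nf

lemma iterate_pderiv_one_binaryForm (n p : ℕ) (c : ℂ) (a : ℕ → ℂ) :
    (fun q => pderiv (1 : Fin 2) q)^[p] (C c * binaryForm (n + p) a) =
      C (c * (n + p).descFactorial p) * binaryForm n (fun j => a (j + p)) := by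
  induction p generalizing c a with
  | zero => simp
  | succ p ih =>
    rw [Function.iterate_succ_apply, pderiv_C_mul, ← add_assoc, pderiv_one_binaryForm,
      ← mul_assoc, ← C_mul, ih, Nat.succ_descFactorial_succ]
    simp only [add_assoc]
    push_cast
    ring_nf

lemma iterate_pderiv_binaryForm (n p q : ℕ) (a : ℕ → ℂ) :
    (fun g => pderiv (0 : Fin 2) g)^[p]
      ((fun g => pderiv (1 : Fin 2) g)^[q] (binaryForm (n + (p + q)) a)) =
      C ((n + (p + q)).descFactorial (p + q) : ℂ) * binaryForm n (fun j => a (j + q)) := by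
  have h := iterate_pderiv_one_binaryForm (n + p) q 1 a
  rw [C_1, one_mul] at h
  rw [← add_assoc, h, iterate_pderiv_zero_C_mul_binaryForm, one_mul, ← Nat.cast_mul, mul_comm,
    add_comm p q, ← Nat.descFactorial_mul_descFactorial (Nat.le_add_right q p)]
  simp [mul_comm]

/-- The coefficients of the `k`-th transvectant with itself of the binary form of degree `N + k`
with normalised coefficients `a`, up to a common factor. -/
noncomputable def transvCoeff (N k w : ℕ) (a : ℕ → ℂ) : ℂ :=
  ∑ i ∈ Finset.range (k + 1), (-1 : ℂ) ^ i * (k.choose i : ℂ) *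
    ∑ p ∈ Finset.HasAntidiagonal.antidiagonal w,
      (N.choose p.1 : ℂ) * a (p.1 + i) * ((N.choose p.2 : ℂ) * a (p.2 + (k - i)))

lemma aeval_binaryForm_coeff (n w : ℕ) (a : ℕ → ℂ) :
    (aeval ![1, Polynomial.X] (binaryForm n a) : Polynomial ℂ).coeff w = n.choose w * a w := by
  simp only [binaryForm, map_sum, map_mul, map_pow, aeval_X, Matrix.cons_val_zero,
    Matrix.cons_val_one, one_pow, mul_one, algHom_C, ← Polynomial.C_eq_algebraMap,
    Polynomial.finsetSum_coeff]
  by_cases h : w < n + 1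
  · rw [Finset.sum_eq_single w]
    · rw [← Polynomial.C_mul, Polynomial.coeff_C_mul_X_pow, if_pos rfl]
    · intro j _ hj
      rw [← Polynomial.C_mul, Polynomial.coeff_C_mul_X_pow, if_neg (Ne.symm hj)]
    · exact fun h' => absurd (Finset.mem_range.2 h) h'
  · rw [Nat.choose_eq_zero_of_lt (by omega), Nat.cast_zero, zero_mul]
    refine Finset.sum_eq_zero fun j hj => ?_
    have := Finset.mem_range.1 hj
    rw [← Polynomial.C_mul, Polynomial.coeff_C_mul_X_pow, if_neg (by omega)]

lemma transvCoeff_eq_zero {N k : ℕ} {a : ℕ → ℂ}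
    (h : transv (N + k) (N + k) k (binaryForm (N + k) a) (binaryForm (N + k) a) = 0) (w : ℕ) :
    transvCoeff N k w a = 0 := by
  unfold transv at h
  rw [smul_eq_zero] at h
  have hn : ∀ m : ℕ, ((m.factorial : ℕ) : ℂ) ≠ 0 := fun m => by
    exact_mod_cast m.factorial_ne_zero
  replace h := h.resolve_left (by
    rw [Nat.cast_mul, Nat.cast_mul]
    exact div_ne_zero (mul_ne_zero (hn _) (hn _)) (mul_ne_zero (hn _) (hn _)))
  set D : ℂ := ((N + k).descFactorial k : ℂ) with hD
  have hD0 : D ≠ 0 := by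
    rw [hD, Nat.cast_ne_zero, Ne, Nat.descFactorial_eq_zero_iff_lt]
    omega
  have h1 : ∀ i ∈ Finset.range (k + 1),
      ((-1 : ℂ) ^ i * (k.choose i : ℂ)) •
        ((fun p => pderiv (0 : Fin 2) p)^[k - i]
          ((fun p => pderiv (1 : Fin 2) p)^[i] (binaryForm (N + k) a)) *
         (fun p => pderiv (0 : Fin 2) p)^[i]
          ((fun p => pderiv (1 : Fin 2) p)^[k - i] (binaryForm (N + k) a))) =
      ((-1 : ℂ) ^ i * (k.choose i : ℂ)) • ((C D * binaryForm N fun j => a (j + i)) *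
        (C D * binaryForm N fun j => a (j + (k - i)))) := by
    intro i hi
    have hi' := Finset.mem_range_succ_iff.1 hi
    have e1 := iterate_pderiv_binaryForm N (k - i) i a
    have e2 := iterate_pderiv_binaryForm N i (k - i) a
    rw [show k - i + i = k by omega] at e1
    rw [show i + (k - i) = k by omega] at e2
    rw [e1, e2]
  rw [Finset.sum_congr rfl h1] at h
  have h2 := congrArg
    (fun p => (aeval ![1, Polynomial.X] p : Polynomial ℂ).coeff w) h
  simp only [map_sum, map_smul, map_mul, map_zero, Polynomial.coeff_zero, algHom_C,
    ← Polynomial.C_eq_algebraMap, Polynomial.finsetSum_coeff, Polynomial.coeff_smul,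
    smul_eq_mul] at h2
  have h3 : D ^ 2 * transvCoeff N k w a = 0 := by
    rw [← h2, transvCoeff, Finset.mul_sum]
    refine Finset.sum_congr rfl fun i _ => ?_
    rw [mul_mul_mul_comm (Polynomial.C D), ← Polynomial.C_mul, Polynomial.coeff_C_mul,
      Polynomial.coeff_mul]
    simp only [aeval_binaryForm_coeff]
    ring
  exact (mul_eq_zero.1 h3).resolve_left (pow_ne_zero 2 hD0)

/-- The normalised coefficients of the form obtained by substituting `x + s y` for `x`. -/
noncomputable def shiftCoeff (s : ℂ) (a : ℕ → ℂ) (w : ℕ) : ℂ :=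
  ∑ u ∈ Finset.range (w + 1), (w.choose u : ℂ) * s ^ (w - u) * a u

lemma binaryForm_shiftCoeff (s : ℂ) (a : ℕ → ℂ) :
    binaryForm 10 (shiftCoeff s a) = aeval ![X 0 + C s * X 1, X 1] (binaryForm 10 a) := by
  simp only [binaryForm, map_sum, map_mul, map_pow, algHom_C, aeval_X, algebraMap_eq]
  simp [shiftCoeff, Finset.sum_range_succ, Nat.choose]
  ring

lemma binaryForm_reverse (n : ℕ) (a : ℕ → ℂ) :
    binaryForm n (fun i => a (n - i)) = aeval ![X 1, X 0] (binaryForm n a) := by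
  rw [binaryForm, ← Finset.sum_range_reflect, binaryForm, map_sum]
  refine Finset.sum_congr rfl fun j hj => ?_
  have hj' := Finset.mem_range_succ_iff.1 hj
  have h1 : n + 1 - 1 - j = n - j := by omega
  have h2 : n - (n - j) = j := by omega
  rw [h1, h2, Nat.choose_symm hj']
  simp
  ring

lemma HasRootOfMult.map_linear {r : ℕ} {f : MvPolynomial (Fin 2) ℂ} (h : HasRootOfMult r f)
    {α β γ δ : ℂ} (hdet : α * δ - β * γ ≠ 0) :
    HasRootOfMult r (aeval ![C α * X 0 + C β * X 1, C γ * X 0 + C δ * X 1] f) := by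
  obtain ⟨a, b, hab, g, rfl⟩ := h
  refine ⟨a * α + b * γ, a * β + b * δ, ?_, ?_⟩
  · by_contra! h0
    obtain ⟨h1, h2⟩ := h0
    have ha : a * (α * δ - β * γ) = 0 := by linear_combination δ * h1 - γ * h2
    have hb : b * (α * δ - β * γ) = 0 := by linear_combination α * h2 - β * h1
    rcases hab with h | h
    · exact mul_ne_zero h hdet ha
    · exact mul_ne_zero h hdet hb
  · rw [map_mul, map_pow]
    refine Dvd.intro _ (congrArg (· ^ r * _) ?_)
    simp
    ring

lemma hasRootOfMult_of_shiftCoeff {r : ℕ} (s : ℂ) {a : ℕ → ℂ}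
    (h : HasRootOfMult r (binaryForm 10 (shiftCoeff s a))) :
    HasRootOfMult r (binaryForm 10 a) := by
  have h' := h.map_linear (α := 1) (β := -s) (γ := 0) (δ := 1) (by simp)
  rw [binaryForm_shiftCoeff, ← AlgHom.comp_apply] at h'
  convert h'
  refine (DFunLike.congr_fun (algHom_ext (f := AlgHom.id ℂ _) fun i => ?_) _ :
    AlgHom.id ℂ _ (binaryForm 10 a) = _)
  fin_cases i <;> simp

lemma hasRootOfMult_of_reverse {n r : ℕ} {a : ℕ → ℂ}
    (h : HasRootOfMult r (binaryForm n fun i => a (n - i))) :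
    HasRootOfMult r (binaryForm n a) := by
  have h' := h.map_linear (α := 0) (β := 1) (γ := 1) (δ := 0) (by simp)
  rw [binaryForm_reverse, ← AlgHom.comp_apply] at h'
  convert h'
  refine (DFunLike.congr_fun (algHom_ext (f := AlgHom.id ℂ _) fun i => ?_) _ :
    AlgHom.id ℂ _ (binaryForm n a) = _)
  fin_cases i <;> simp

/-- The vanishing of all coefficients of the transvectants of orders 6, 8 and 10 with itself of the
binary form of degree 10 with normalised coefficients `a`. -/
structure TransvVanish (a : ℕ → ℂ) : Prop where
  six_zero : 2 * a 0 * a 6 - 12 * a 1 * a 5 + 30 * a 2 * a 4 - 20 * a 3 ^ 2 = 0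
  six_one : 8 * a 0 * a 7 - 40 * a 1 * a 6 + 72 * a 2 * a 5 - 40 * a 3 * a 4 = 0
  six_two : 12 * a 0 * a 8 - 40 * a 1 * a 7 + 168 * a 3 * a 5 - 140 * a 4 ^ 2 = 0
  six_three : 8 * a 0 * a 9 - 120 * a 2 * a 7 + 280 * a 3 * a 6 - 168 * a 4 * a 5 = 0
  six_four :
    2 * a 0 * a 10 + 20 * a 1 * a 9 - 90 * a 2 * a 8 + 40 * a 3 * a 7 +
      280 * a 4 * a 6 - 252 * a 5 ^ 2 = 0
  six_five : 8 * a 1 * a 10 - 120 * a 3 * a 8 + 280 * a 4 * a 7 - 168 * a 5 * a 6 = 0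
  six_six : 12 * a 2 * a 10 - 40 * a 3 * a 9 + 168 * a 5 * a 7 - 140 * a 6 ^ 2 = 0
  six_seven : 8 * a 3 * a 10 - 40 * a 4 * a 9 + 72 * a 5 * a 8 - 40 * a 6 * a 7 = 0
  six_eight : 2 * a 4 * a 10 - 12 * a 5 * a 9 + 30 * a 6 * a 8 - 20 * a 7 ^ 2 = 0
  eight_zero : 2 * a 0 * a 8 - 16 * a 1 * a 7 + 56 * a 2 * a 6 - 112 * a 3 * a 5 + 70 * a 4 ^ 2 = 0
  eight_one : 4 * a 0 * a 9 - 28 * a 1 * a 8 + 80 * a 2 * a 7 - 112 * a 3 * a 6 + 56 * a 4 * a 5 = 0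
  eight_two :
    2 * a 0 * a 10 - 8 * a 1 * a 9 - 6 * a 2 * a 8 + 96 * a 3 * a 7 -
      252 * a 4 * a 6 + 168 * a 5 ^ 2 = 0
  eight_three :
    4 * a 1 * a 10 - 28 * a 2 * a 9 + 80 * a 3 * a 8 - 112 * a 4 * a 7 + 56 * a 5 * a 6 = 0
  eight_four : 2 * a 2 * a 10 - 16 * a 3 * a 9 + 56 * a 4 * a 8 - 112 * a 5 * a 7 + 70 * a 6 ^ 2 = 0
  ten_zero :
    2 * a 0 * a 10 - 20 * a 1 * a 9 + 90 * a 2 * a 8 - 240 * a 3 * a 7 +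
      420 * a 4 * a 6 - 252 * a 5 ^ 2 = 0

lemma TransvVanish.of_transvCoeff {a : ℕ → ℂ} (h6 : ∀ w, transvCoeff 4 6 w a = 0)
    (h8 : ∀ w, transvCoeff 2 8 w a = 0) (h10 : ∀ w, transvCoeff 0 10 w a = 0) :
    TransvVanish a := by
  simp only [transvCoeff, Finset.sum_range_succ, Finset.sum_range_zero] at h6 h8 h10
  constructor
  · have := h6 0
    simp [Nat.choose] at this
    linear_combination this
  · have := h6 1
    simp [Finset.Nat.antidiagonal_succ, Nat.choose] at this
    linear_combination this
  · have := h6 2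
    simp [Finset.Nat.antidiagonal_succ, Nat.choose] at this
    linear_combination this
  · have := h6 3
    simp [Finset.Nat.antidiagonal_succ, Nat.choose] at this
    linear_combination this
  · have := h6 4
    simp [Finset.Nat.antidiagonal_succ, Nat.choose] at this
    linear_combination this
  · have := h6 5
    simp [Finset.Nat.antidiagonal_succ, Nat.choose] at this
    linear_combination this
  · have := h6 6
    simp [Finset.Nat.antidiagonal_succ, Nat.choose] at this
    linear_combination this
  · have := h6 7
    simp [Finset.Nat.antidiagonal_succ, Nat.choose] at this
    linear_combination this
  · have := h6 8
    simp [Finset.Nat.antidiagonal_succ, Nat.choose] at this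
    linear_combination this
  · have := h8 0
    simp [Nat.choose] at this
    linear_combination this
  · have := h8 1
    simp [Finset.Nat.antidiagonal_succ, Nat.choose] at this
    linear_combination this
  · have := h8 2
    simp [Finset.Nat.antidiagonal_succ, Nat.choose] at this
    linear_combination this
  · have := h8 3
    simp [Finset.Nat.antidiagonal_succ, Nat.choose] at this
    linear_combination this
  · have := h8 4
    simp [Finset.Nat.antidiagonal_succ, Nat.choose] at this
    linear_combination this
  · have := h10 0
    simp [Nat.choose] at this
    linear_combination this

lemma TransvVanish.reverse {a : ℕ → ℂ} (h : TransvVanish a) :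
    TransvVanish fun i => a (10 - i) where
  six_zero := by linear_combination h.six_eight
  six_one := by linear_combination h.six_seven
  six_two := by linear_combination h.six_six
  six_three := by linear_combination h.six_five
  six_four := by linear_combination h.six_four
  six_five := by linear_combination h.six_three
  six_six := by linear_combination h.six_two
  six_seven := by linear_combination h.six_one
  six_eight := by linear_combination h.six_zero
  eight_zero := by linear_combination h.eight_four
  eight_one := by linear_combination h.eight_three
  eight_two := by linear_combination h.eight_two
  eight_three := by linear_combination h.eight_one
  eight_four := by linear_combination h.eight_zero
  ten_zero := by linear_combination h.ten_zero

lemma TransvVanish.shift {a : ℕ → ℂ} (h : TransvVanish a) (s : ℂ) :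
    TransvVanish (shiftCoeff s a) := by
  constructor <;> simp only [shiftCoeff, Finset.sum_range_succ, Finset.sum_range_zero, Nat.choose] <;>
    push_cast
  · linear_combination h.six_zero
  · linear_combination h.six_one + 8 * s * h.six_zero
  · linear_combination h.six_two + 7 * s * h.six_one + 28 * s ^ 2 * h.six_zero
  · linear_combination h.six_three + 6 * s * h.six_two + 21 * s ^ 2 * h.six_one +
      56 * s ^ 3 * h.six_zero
  · linear_combination h.six_four + 5 * s * h.six_three + 15 * s ^ 2 * h.six_two +
      35 * s ^ 3 * h.six_one + 70 * s ^ 4 * h.six_zero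
  · linear_combination h.six_five + 4 * s * h.six_four + 10 * s ^ 2 * h.six_three +
      20 * s ^ 3 * h.six_two + 35 * s ^ 4 * h.six_one + 56 * s ^ 5 * h.six_zero
  · linear_combination h.six_six + 3 * s * h.six_five + 6 * s ^ 2 * h.six_four +
      10 * s ^ 3 * h.six_three + 15 * s ^ 4 * h.six_two + 21 * s ^ 5 * h.six_one +
      28 * s ^ 6 * h.six_zero
  · linear_combination h.six_seven + 2 * s * h.six_six + 3 * s ^ 2 * h.six_five +
      4 * s ^ 3 * h.six_four + 5 * s ^ 4 * h.six_three + 6 * s ^ 5 * h.six_two +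
      7 * s ^ 6 * h.six_one + 8 * s ^ 7 * h.six_zero
  · linear_combination h.six_eight + s * h.six_seven + s ^ 2 * h.six_six +
      s ^ 3 * h.six_five + s ^ 4 * h.six_four + s ^ 5 * h.six_three +
      s ^ 6 * h.six_two + s ^ 7 * h.six_one + s ^ 8 * h.six_zero
  · linear_combination h.eight_zero
  · linear_combination h.eight_one + 4 * s * h.eight_zero
  · linear_combination h.eight_two + 3 * s * h.eight_one + 6 * s ^ 2 * h.eight_zero
  · linear_combination h.eight_three + 2 * s * h.eight_two + 3 * s ^ 2 * h.eight_one +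
      4 * s ^ 3 * h.eight_zero
  · linear_combination h.eight_four + s * h.eight_three + s ^ 2 * h.eight_two +
      s ^ 3 * h.eight_one + s ^ 4 * h.eight_zero
  · linear_combination h.ten_zero

lemma hasRootOfMult_of_simple_root {a : ℕ → ℂ} (h : TransvVanish a) (h0 : a 0 = 0)
    (h1 : a 1 ≠ 0) (h2 : a 2 = 0) : HasRootOfMult 8 (binaryForm 10 a) := by
  have e0 := h.six_zero
  have e1 := h.six_one
  have e2 := h.six_two
  have e4 := h.six_four
  have e5 := h.six_five
  have d0 := h.eight_zero
  have d1 := h.eight_one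
  simp only [h0, h2] at e0 e1 e2 e4 e5 d0 d1
  have key : 27 * a 1 * a 4 ^ 2 = -64 * a 3 ^ 3 := by
    linear_combination (-3 * a 1 / 35) * (e2 - 5 / 2 * d0) - (16 * a 3 / 5) * e0
  obtain ⟨q, h3, h4⟩ : ∃ q, a 3 = -3 * a 1 * q ^ 2 ∧ a 4 = -8 * a 1 * q ^ 3 := by
    by_cases h3 : a 3 = 0
    · refine ⟨0, by simp [h3], ?_⟩
      rw [h3] at key
      have : a 1 * a 4 ^ 2 = 0 := by linear_combination key / 27
      simpa [h1] using this
    · have hq : a 3 = -3 * a 1 * (3 * a 4 / (8 * a 3)) ^ 2 := by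
        field_simp
        linear_combination key
      refine ⟨3 * a 4 / (8 * a 3), hq, ?_⟩
      have : a 4 = 8 / 3 * a 3 * (3 * a 4 / (8 * a 3)) := by field_simp
      linear_combination this + 8 / 3 * (3 * a 4 / (8 * a 3)) * hq
  have h5 : a 5 = -15 * a 1 * q ^ 4 := by
    refine mul_left_cancel₀ h1 ?_
    rw [h3] at e0
    linear_combination -e0 / 12
  have h6 : a 6 = -24 * a 1 * q ^ 5 := by
    refine mul_left_cancel₀ h1 ?_
    rw [h3, h4] at e1
    linear_combination -e1 / 40
  have h7 : a 7 = -35 * a 1 * q ^ 6 := by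
    refine mul_left_cancel₀ h1 ?_
    rw [h3, h4, h5] at e2
    linear_combination -e2 / 40
  have h8 : a 8 = -48 * a 1 * q ^ 7 := by
    refine mul_left_cancel₀ h1 ?_
    rw [h3, h4, h5, h6] at d1
    linear_combination -d1 / 28
  have h9 : a 9 = -63 * a 1 * q ^ 8 := by
    refine mul_left_cancel₀ h1 ?_
    rw [h3, h4, h5, h6, h7] at e4
    linear_combination e4 / 20
  have h10 : a 10 = -80 * a 1 * q ^ 9 := by
    refine mul_left_cancel₀ h1 ?_
    rw [h3, h4, h5, h6, h7, h8] at e5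
    linear_combination e5 / 8
  refine ⟨1, q, Or.inl one_ne_zero, 10 * C (a 1) * X 1 * (X 0 - 8 * C q * X 1), ?_⟩
  simp [binaryForm, Finset.sum_range_succ, Nat.choose, C_ofNat, h0, h2, h3, h4, h5, h6, h7, h8, h9, h10]
  ring

lemma hasRootOfMult_of_double_root {a : ℕ → ℂ} (h : TransvVanish a) (h0 : a 0 = 0)
    (h1 : a 1 = 0) (h2 : a 2 ≠ 0) (h3 : a 3 = 0) : HasRootOfMult 8 (binaryForm 10 a) := by
  have e0 := h.six_zero
  have e1 := h.six_one
  have e4 := h.six_four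
  have d0 := h.eight_zero
  have d1 := h.eight_one
  have d3 := h.eight_three
  have d4 := h.eight_four
  simp only [h0, h1, h3] at e0 e1 e4 d0 d1 d3 d4
  have h4 : a 4 = 0 := (mul_eq_zero_iff_left h2).1 (by linear_combination e0 / 30)
  have h5 : a 5 = 0 := (mul_eq_zero_iff_left h2).1 (by linear_combination e1 / 72)
  simp only [h4, h5] at e4 d0 d1 d3 d4
  have h6 : a 6 = 0 := (mul_eq_zero_iff_left h2).1 (by linear_combination d0 / 56)
  have h7 : a 7 = 0 := (mul_eq_zero_iff_left h2).1 (by linear_combination d1 / 80)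
  have h8 : a 8 = 0 := (mul_eq_zero_iff_left h2).1 (by linear_combination -e4 / 90)
  have h9 : a 9 = 0 := (mul_eq_zero_iff_left h2).1 (by linear_combination -d3 / 28)
  have h10 : a 10 = 0 := (mul_eq_zero_iff_left h2).1
    (by rw [h6] at d4; linear_combination d4 / 2)
  refine ⟨1, 0, Or.inl one_ne_zero, 45 * C (a 2) * X 1 ^ 2, ?_⟩
  simp [binaryForm, Finset.sum_range_succ, Nat.choose, h0, h1, h3, h4, h5, h6, h7, h8, h9, h10]
  ring

lemma hasRootOfMult_of_triple_root {a : ℕ → ℂ} (h : TransvVanish a) (h0 : a 0 = 0)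
    (h1 : a 1 = 0) (h2 : a 2 = 0) : HasRootOfMult 8 (binaryForm 10 a) := by
  have e0 := h.six_zero
  have e2 := h.six_two
  have e4 := h.six_four
  have e6 := h.six_six
  have e8 := h.six_eight
  simp only [h0, h1, h2] at e0 e2 e4 e6 e8
  have h3 : a 3 = 0 := pow_eq_zero_iff two_ne_zero |>.1 (by linear_combination -e0 / 20)
  simp only [h3] at e2 e4 e6 e8
  have h4 : a 4 = 0 := pow_eq_zero_iff two_ne_zero |>.1 (by linear_combination -e2 / 140)
  simp only [h4] at e4 e6 e8
  have h5 : a 5 = 0 := pow_eq_zero_iff two_ne_zero |>.1 (by linear_combination -e4 / 252)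
  simp only [h5] at e6 e8
  have h6 : a 6 = 0 := pow_eq_zero_iff two_ne_zero |>.1 (by linear_combination -e6 / 140)
  simp only [h6] at e8
  have h7 : a 7 = 0 := pow_eq_zero_iff two_ne_zero |>.1 (by linear_combination -e8 / 20)
  refine ⟨0, 1, Or.inr one_ne_zero,
    45 * C (a 8) * X 0 ^ 2 + 10 * C (a 9) * X 0 * X 1 + C (a 10) * X 1 ^ 2, ?_⟩
  simp [binaryForm, Finset.sum_range_succ, Nat.choose, h0, h1, h2, h3, h4, h5, h6, h7]
  ring

lemma hasRootOfMult_of_root {a : ℕ → ℂ} (h : TransvVanish a) (h0 : a 0 = 0) :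
    HasRootOfMult 8 (binaryForm 10 a) := by
  by_cases h1 : a 1 = 0
  · by_cases h2 : a 2 = 0
    · exact hasRootOfMult_of_triple_root h h0 h1 h2
    · refine hasRootOfMult_of_shiftCoeff (-a 3 / (3 * a 2))
        (hasRootOfMult_of_double_root (h.shift _) ?_ ?_ ?_ ?_) <;>
        simp [shiftCoeff, Finset.sum_range_succ, Nat.choose, h0, h1, h2]
      field_simp
      ring
  · refine hasRootOfMult_of_shiftCoeff (-a 2 / (2 * a 1))
      (hasRootOfMult_of_simple_root (h.shift _) ?_ ?_ ?_) <;>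
      simp [shiftCoeff, Finset.sum_range_succ, Nat.choose, h0, h1]
    field_simp
    ring

lemma exists_shiftCoeff_ten_eq_zero {a : ℕ → ℂ} (h : ∃ i < 10, a i ≠ 0) :
    ∃ s, shiftCoeff s a 10 = 0 := by
  obtain ⟨i, hi, hai⟩ := h
  let p : Polynomial ℂ := ∑ u ∈ Finset.range 11,
    Polynomial.C ((Nat.choose 10 u : ℂ) * a u) * Polynomial.X ^ (10 - u)
  have hp : p.coeff (10 - i) ≠ 0 := by
    simp only [p, Polynomial.finsetSum_coeff, Polynomial.coeff_C_mul_X_pow]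
    rw [Finset.sum_eq_single i]
    · rw [if_pos rfl]
      exact mul_ne_zero (by exact_mod_cast (Nat.choose_pos hi.le).ne') hai
    · intro j hj hji
      have := Finset.mem_range.1 hj
      exact if_neg (by omega)
    · exact fun h' => absurd (Finset.mem_range.2 (by omega)) h'
  have hdeg : p.degree ≠ 0 := by
    intro hd
    have := Polynomial.le_degree_of_ne_zero hp
    rw [hd] at this
    have : 10 - i ≤ 0 := by exact_mod_cast this
    omega
  obtain ⟨s, hs⟩ := IsAlgClosed.exists_root p hdeg
  refine ⟨s, ?_⟩
  rw [← hs.eq_zero]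
  simp only [shiftCoeff, p, Polynomial.eval_finsetSum, Polynomial.eval_mul, Polynomial.eval_C,
    Polynomial.eval_pow, Polynomial.eval_X]
  exact Finset.sum_congr rfl fun u _ => by ring

/-- Let `f ∈ V₁₀`. If the transvectants `(f,f)₁₀`, `(f,f)₈` and `(f,f)₆` all vanish,
then `f` has a root of multiplicity at least 8. -/
theorem j2_k_q_zero_case (f : MvPolynomial (Fin 2) ℂ) (hf : f.IsHomogeneous 10)
    (hj2 : transv 10 10 10 f f = 0)
    (hk : transv 10 10 8 f f = 0)
    (hq : transv 10 10 6 f f = 0) :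
    HasRootOfMult 8 f := by
  obtain ⟨a, rfl⟩ := exists_eq_binaryForm hf
  have ha : TransvVanish a := .of_transvCoeff (transvCoeff_eq_zero (N := 4) hq)
    (transvCoeff_eq_zero (N := 2) hk) (transvCoeff_eq_zero (N := 0) hj2)
  by_cases h : ∃ i < 10, a i ≠ 0
  · obtain ⟨s, hs⟩ := exists_shiftCoeff_ten_eq_zero h
    exact hasRootOfMult_of_shiftCoeff s (hasRootOfMult_of_reverse
      (hasRootOfMult_of_root (ha.shift s).reverse hs))
  · push Not at h
    exact hasRootOfMult_of_root ha (h 0 (by norm_num))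
end

section
/- Let f ∈ V_10 and set k = (f,f)_8 ∈ V_4, m = (f,k)_4 ∈ V_6, k_m = (m,m)_4, and invariants A_6 = (m,m)_6, j_8 = (k,k_m)_4, j_10 = ((m,m)_2,k^2)_8, A_12 = (m^2,k^3)_12. If k is a nonzero scalar multiple of x^4 and A_6(f) = j_8(f) = j_10(f) = A_12(f) = 0, then x^6 divides f; in particular f has a root of multiplicity at least 6. -/
open MvPolynomial

/-- The covariant `k = (f,f)₈ ∈ V₄` of a binary decimic `f`. -/
noncomputable def covK (f : MvPolynomial (Fin 2) ℂ) : MvPolynomial (Fin 2) ℂ :=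
  transv 10 10 8 f f

/-- The covariant `m = (f,k)₄ ∈ V₆` of a binary decimic `f`. -/
noncomputable def covM (f : MvPolynomial (Fin 2) ℂ) : MvPolynomial (Fin 2) ℂ :=
  transv 10 4 4 f (covK f)

/-- The covariant `q = (f,f)₆ ∈ V₈` of a binary decimic `f`. -/
noncomputable def covQ (f : MvPolynomial (Fin 2) ℂ) : MvPolynomial (Fin 2) ℂ :=
  transv 10 10 6 f f

/-- The covariant `r = (f,q)₈ ∈ V₂` of a binary decimic `f`. -/
noncomputable def covR (f : MvPolynomial (Fin 2) ℂ) : MvPolynomial (Fin 2) ℂ :=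
  transv 10 8 8 f (covQ f)

/-- The covariant `k_q = (q,q)₆ ∈ V₄` of a binary decimic `f`. -/
noncomputable def covKq (f : MvPolynomial (Fin 2) ℂ) : MvPolynomial (Fin 2) ℂ :=
  transv 8 8 6 (covQ f) (covQ f)

/-- The covariant `k_m = (m,m)₄ ∈ V₄` of a binary decimic `f`. -/
noncomputable def covKm (f : MvPolynomial (Fin 2) ℂ) : MvPolynomial (Fin 2) ℂ :=
  transv 6 6 4 (covM f) (covM f)

/-- The covariant `m_q = (q,k_q)₄ ∈ V₄` of a binary decimic `f`. -/
noncomputable def covMq (f : MvPolynomial (Fin 2) ℂ) : MvPolynomial (Fin 2) ℂ :=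
  transv 8 4 4 (covQ f) (covKq f)

/-- The invariant `j₂ = (f,f)₁₀` of a binary decimic `f` (a form of order 0, i.e. a
constant polynomial). -/
noncomputable def j2 (f : MvPolynomial (Fin 2) ℂ) : MvPolynomial (Fin 2) ℂ :=
  transv 10 10 10 f f

/-- The invariant `j₄ = (k,k)₄` of a binary decimic `f`. -/
noncomputable def j4 (f : MvPolynomial (Fin 2) ℂ) : MvPolynomial (Fin 2) ℂ :=
  transv 4 4 4 (covK f) (covK f)

/-- The invariant `j₆ = ((k,k)₂,k)₄` of a binary decimic `f`. -/
noncomputable def j6 (f : MvPolynomial (Fin 2) ℂ) : MvPolynomial (Fin 2) ℂ :=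
  transv 4 4 4 (transv 4 4 2 (covK f) (covK f)) (covK f)

/-- The invariant `A₆ = (m,m)₆` of a binary decimic `f`. -/
noncomputable def A6 (f : MvPolynomial (Fin 2) ℂ) : MvPolynomial (Fin 2) ℂ :=
  transv 6 6 6 (covM f) (covM f)

/-- The invariant `B₆ = ((q,q)₄,q)₈` of a binary decimic `f`. -/
noncomputable def B6 (f : MvPolynomial (Fin 2) ℂ) : MvPolynomial (Fin 2) ℂ :=
  transv 8 8 8 (transv 8 8 4 (covQ f) (covQ f)) (covQ f)

/-- The invariant `C₆ = (r,r)₂` of a binary decimic `f`. -/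
noncomputable def C6 (f : MvPolynomial (Fin 2) ℂ) : MvPolynomial (Fin 2) ℂ :=
  transv 2 2 2 (covR f) (covR f)

/-- The invariant `j₈ = (k,k_m)₄` of a binary decimic `f`. -/
noncomputable def j8 (f : MvPolynomial (Fin 2) ℂ) : MvPolynomial (Fin 2) ℂ :=
  transv 4 4 4 (covK f) (covKm f)

/-- The invariant `j₉ = ((m,k)₁,k²)₈` of a binary decimic `f`. -/
noncomputable def j9 (f : MvPolynomial (Fin 2) ℂ) : MvPolynomial (Fin 2) ℂ :=
  transv 8 8 8 (transv 6 4 1 (covM f) (covK f)) (covK f ^ 2)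

/-- The invariant `j₁₀ = ((m,m)₂,k²)₈` of a binary decimic `f`. -/
noncomputable def j10 (f : MvPolynomial (Fin 2) ℂ) : MvPolynomial (Fin 2) ℂ :=
  transv 8 8 8 (transv 6 6 2 (covM f) (covM f)) (covK f ^ 2)

/-- The invariant `A₁₂ = (m²,k³)₁₂` of a binary decimic `f`. -/
noncomputable def A12 (f : MvPolynomial (Fin 2) ℂ) : MvPolynomial (Fin 2) ℂ :=
  transv 12 12 12 (covM f ^ 2) (covK f ^ 3)

/-- The invariant `j₁₄ = ((k_q,k_q)₂,m_q)₄` of a binary decimic `f`. -/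
noncomputable def j14 (f : MvPolynomial (Fin 2) ℂ) : MvPolynomial (Fin 2) ℂ :=
  transv 4 4 4 (transv 4 4 2 (covKq f) (covKq f)) (covMq f)

/-- The invariant `A₁₄ = (((k,k)₂)²,(m,m)₂)₈` of a binary decimic `f`. -/
noncomputable def A14 (f : MvPolynomial (Fin 2) ℂ) : MvPolynomial (Fin 2) ℂ :=
  transv 8 8 8 (transv 4 4 2 (covK f) (covK f) ^ 2) (transv 6 6 2 (covM f) (covM f))

/-- The binary form `∑ binom(n,i) aᵢ x^(n-i) y^i` of degree `n` with normalized coefficients `a`. -/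
noncomputable def binForm (n : ℕ) (a : ℕ → ℂ) : MvPolynomial (Fin 2) ℂ :=
  ∑ i ∈ Finset.range (n + 1), C ((n.choose i : ℂ) * a i) * X 0 ^ (n - i) * X 1 ^ i

theorem binForm_add (n : ℕ) (a b : ℕ → ℂ) :
    binForm n (a + b) = binForm n a + binForm n b := by
  simp only [binForm, ← Finset.sum_add_distrib]
  refine Finset.sum_congr rfl fun i _ => ?_
  simp only [Pi.add_apply, mul_add, add_mul, map_add]

theorem binForm_single (n j : ℕ) (hj : j ≤ n) (z : ℂ) :
    binForm n (Pi.single j z) = C ((n.choose j : ℂ) * z) * X 0 ^ (n - j) * X 1 ^ j := by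
  rw [binForm, Finset.sum_eq_single j]
  · simp
  · intro i _ hi
    simp [Pi.single_eq_of_ne hi]
  · intro h
    exact absurd (Finset.mem_range.2 (by omega)) h

theorem exists_eq_binForm {n : ℕ} {f : MvPolynomial (Fin 2) ℂ} (hf : f.IsHomogeneous n) :
    ∃ a, f = binForm n a := by
  rw [f.as_sum]
  refine Finset.sum_induction _ (fun p => ∃ a, p = binForm n a) ?_ ?_ ?_
  · rintro _ _ ⟨a, rfl⟩ ⟨b, rfl⟩
    exact ⟨a + b, (binForm_add n a b).symm⟩
  · exact ⟨0, by simp [binForm]⟩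
  · intro d hd
    have hdeg : d 0 + d 1 = n := by
      have h := hf (mem_support_iff.1 hd)
      rw [Finsupp.weight_apply, Finsupp.sum_fintype _ _ (by simp)] at h
      simpa [Fin.sum_univ_two] using h
    have hle : d 1 ≤ n := by omega
    have hch : (n.choose (d 1) : ℂ) ≠ 0 := by
      exact_mod_cast (Nat.choose_pos hle).ne'
    refine ⟨Pi.single (d 1) (coeff d f / n.choose (d 1)), ?_⟩
    rw [binForm_single n _ hle, mul_div_cancel₀ _ hch, monomial_eq,
      Finsupp.prod_fintype _ _ (by simp), Fin.prod_univ_two, mul_assoc,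
      show n - d 1 = d 0 by omega]

theorem isHomogeneous_binForm (n : ℕ) (a : ℕ → ℂ) : (binForm n a).IsHomogeneous n := by
  refine IsHomogeneous.sum _ _ _ fun i hi => ?_
  have hi' := Finset.mem_range.1 hi
  have h := ((isHomogeneous_C (Fin 2) ((n.choose i : ℂ) * a i)).mul
    (isHomogeneous_X_pow (R := ℂ) (0 : Fin 2) (n - i))).mul
    (isHomogeneous_X_pow (R := ℂ) (1 : Fin 2) i)
  rwa [show 0 + (n - i) + i = n by omega] at h

theorem pderiv_zero_binForm (n : ℕ) (a : ℕ → ℂ) :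
    pderiv 0 (binForm (n + 1) a) = ((n + 1 : ℕ) : ℂ) • binForm n a := by
  rw [binForm, Finset.sum_range_succ, binForm, map_add, map_sum, Finset.smul_sum]
  have hlast : pderiv (0 : Fin 2) (C (((n + 1).choose (n + 1) : ℂ) * a (n + 1)) *
      X 0 ^ (n + 1 - (n + 1)) * X 1 ^ (n + 1)) = (0 : MvPolynomial (Fin 2) ℂ) := by
    simp [pderiv_X]
  rw [hlast, add_zero]
  refine Finset.sum_congr rfl fun i hi => ?_
  have hi' := Finset.mem_range.1 hi
  have hc : (n.choose i : ℂ) * ((n + 1 : ℕ) : ℂ) = (n + 1).choose i * ((n - i + 1 : ℕ) : ℂ) := by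
    have h := Nat.choose_mul_succ_eq n i
    rw [show n + 1 - i = n - i + 1 by omega] at h
    exact_mod_cast h
  have hC := congrArg (C (σ := Fin 2)) hc
  rw [show n + 1 - i = n - i + 1 by omega, smul_eq_C_mul]
  simp [pderiv_X] at hC ⊢
  linear_combination (-C (a i) * X 0 ^ (n - i) * X 1 ^ i) * hC

theorem pderiv_one_binForm (n : ℕ) (a : ℕ → ℂ) :
    pderiv 1 (binForm (n + 1) a) = ((n + 1 : ℕ) : ℂ) • binForm n (fun i => a (i + 1)) := by
  rw [binForm, Finset.sum_range_succ', binForm, map_add, map_sum, Finset.smul_sum]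
  have hlast : pderiv (1 : Fin 2) (C (((n + 1).choose 0 : ℂ) * a 0) *
      X 0 ^ (n + 1 - 0) * X 1 ^ 0) = (0 : MvPolynomial (Fin 2) ℂ) := by
    simp [pderiv_X]
  rw [hlast, add_zero]
  refine Finset.sum_congr rfl fun i hi => ?_
  have hc : ((n + 1 : ℕ) : ℂ) * (n.choose i : ℂ) = (n + 1).choose (i + 1) * ((i + 1 : ℕ) : ℂ) := by
    exact_mod_cast Nat.add_one_mul_choose_eq n i
  have hC := congrArg (C (σ := Fin 2)) hc
  rw [show n + 1 - (i + 1) = n - i by omega, smul_eq_C_mul]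
  simp [pderiv_X] at hC ⊢
  linear_combination (-C (a (i + 1)) * X 0 ^ (n - i) * X 1 ^ i) * hC

theorem iterate_pderiv_zero_binForm (n p : ℕ) (a : ℕ → ℂ) :
    (fun q => pderiv (0 : Fin 2) q)^[p] (binForm (n + p) a) =
      (((n + p).factorial : ℂ) / n.factorial) • binForm n a := by
  induction p generalizing n with
  | zero =>
    have : (n.factorial : ℂ) ≠ 0 := by exact_mod_cast n.factorial_ne_zero
    simp [this]
  | succ p ih =>
    have h := ih (n + 1)
    rw [show n + 1 + p = n + (p + 1) by omega] at h
    have hn : (n.factorial : ℂ) ≠ 0 := by exact_mod_cast n.factorial_ne_zero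
    have hn' : (n : ℂ) + 1 ≠ 0 := by exact_mod_cast n.succ_ne_zero
    rw [Function.iterate_succ_apply', h]
    simp only [Derivation.map_smul, pderiv_zero_binForm, smul_smul, Nat.factorial_succ n]
    congr 1
    push_cast
    field_simp

theorem iterate_pderiv_one_binForm (n p : ℕ) (a : ℕ → ℂ) :
    (fun q => pderiv (1 : Fin 2) q)^[p] (binForm (n + p) a) =
      (((n + p).factorial : ℂ) / n.factorial) • binForm n (fun i => a (i + p)) := by
  induction p generalizing n with
  | zero =>
    have : (n.factorial : ℂ) ≠ 0 := by exact_mod_cast n.factorial_ne_zero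
    simp [this]
  | succ p ih =>
    have h := ih (n + 1)
    rw [show n + 1 + p = n + (p + 1) by omega] at h
    have hn : (n.factorial : ℂ) ≠ 0 := by exact_mod_cast n.factorial_ne_zero
    have hn' : (n : ℂ) + 1 ≠ 0 := by exact_mod_cast n.succ_ne_zero
    rw [Function.iterate_succ_apply', h]
    simp only [Derivation.map_smul, pderiv_one_binForm, smul_smul, Nat.factorial_succ n, add_assoc,
      add_comm 1 p]
    congr 1
    push_cast
    field_simp

theorem iterate_pderiv_smul (j : Fin 2) (p : ℕ) (z : ℂ) (f : MvPolynomial (Fin 2) ℂ) :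
    (fun q => pderiv j q)^[p] (z • f) = z • (fun q => pderiv j q)^[p] f := by
  induction p with
  | zero => rfl
  | succ p ih => simp only [Function.iterate_succ_apply', ih, Derivation.map_smul]

theorem iterate_pderiv_binForm (n p q : ℕ) (a : ℕ → ℂ) :
    (fun r => pderiv (0 : Fin 2) r)^[p] ((fun r => pderiv (1 : Fin 2) r)^[q]
      (binForm (n + (p + q)) a)) =
      (((n + (p + q)).factorial : ℂ) / n.factorial) • binForm n (fun i => a (i + q)) := by
  rw [← add_assoc, iterate_pderiv_one_binForm, iterate_pderiv_smul, iterate_pderiv_zero_binForm,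
    smul_smul]
  have : ((n + p).factorial : ℂ) ≠ 0 := by exact_mod_cast (n + p).factorial_ne_zero
  congr 1
  field_simp

theorem transv_binForm (n m k : ℕ) (a b : ℕ → ℂ) :
    transv (n + k) (m + k) k (binForm (n + k) a) (binForm (m + k) b) =
      ∑ i ∈ Finset.range (k + 1), ((-1 : ℂ) ^ i * (k.choose i : ℂ)) •
        (binForm n (fun j => a (j + i)) * binForm m (fun j => b (j + (k - i)))) := by
  rw [transv, Finset.smul_sum]
  refine Finset.sum_congr rfl fun i hi => ?_
  have hi' := Finset.mem_range.1 hi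
  have h1 := iterate_pderiv_binForm n (k - i) i a
  have h2 := iterate_pderiv_binForm m i (k - i) b
  rw [show k - i + i = k by omega] at h1
  rw [show i + (k - i) = k by omega] at h2
  rw [h1, h2, smul_mul_smul_comm, smul_smul, smul_smul]
  congr 1
  have e1 : ((n + k).factorial : ℂ) ≠ 0 := by exact_mod_cast (n + k).factorial_ne_zero
  have e2 : ((m + k).factorial : ℂ) ≠ 0 := by exact_mod_cast (m + k).factorial_ne_zero
  have e3 : (n.factorial : ℂ) ≠ 0 := by exact_mod_cast n.factorial_ne_zero
  have e4 : (m.factorial : ℂ) ≠ 0 := by exact_mod_cast m.factorial_ne_zero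
  simp only [Nat.add_sub_cancel]
  push_cast
  field_simp

theorem binForm_zero (a : ℕ → ℂ) : binForm 0 a = C (a 0) := by
  simp [binForm]

theorem C_mul_X_pow_eq_binForm (n : ℕ) (c : ℂ) :
    C c * X 0 ^ n = binForm n (Pi.single 0 c) := by
  simp [binForm_single]

theorem eval_binForm (n : ℕ) (a : ℕ → ℂ) (s t : ℂ) :
    eval ![s, t] (binForm n a) =
      ∑ i ∈ Finset.range (n + 1), (n.choose i : ℂ) * a i * s ^ (n - i) * t ^ i := by
  simp [binForm]

theorem eval_zero_one_binForm (n : ℕ) (a : ℕ → ℂ) : eval ![0, 1] (binForm n a) = a n := by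
  rw [eval_binForm, Finset.sum_eq_single n]
  · simp
  · intro i hi hin
    have hi' := Finset.mem_range.1 hi
    rw [zero_pow (by omega)]
    simp
  · simp

theorem isHomogeneous_transv_binForm (n m k : ℕ) (a b : ℕ → ℂ) :
    (transv (n + k) (m + k) k (binForm (n + k) a) (binForm (m + k) b)).IsHomogeneous (n + m) := by
  rw [transv_binForm]
  refine IsHomogeneous.sum _ _ _ fun i _ => ?_
  rw [smul_eq_C_mul]
  have h := (isHomogeneous_C (Fin 2) ((-1 : ℂ) ^ i * (k.choose i : ℂ))).mul
    ((isHomogeneous_binForm n (fun j => a (j + i))).mul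
      (isHomogeneous_binForm m (fun j => b (j + (k - i)))))
  rwa [zero_add] at h

/-- Transvecting with a multiple of `xᵏ` on the right amounts to applying a multiple of `∂ᵏ/∂yᵏ`. -/
theorem transv_binForm_X_pow (n k : ℕ) (a : ℕ → ℂ) (c : ℂ) :
    transv (n + k) k k (binForm (n + k) a) (C c * X 0 ^ k) =
      ((-1 : ℂ) ^ k * c) • binForm n (fun j => a (j + k)) := by
  have h := transv_binForm n 0 k a (Pi.single 0 c)
  rw [zero_add] at h
  rw [C_mul_X_pow_eq_binForm, h, Finset.sum_eq_single k]
  · rw [binForm_zero]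
    simp [smul_eq_C_mul]
    ring
  · intro i hi hik
    have hi' := Finset.mem_range.1 hi
    rw [binForm_zero, Pi.single_eq_of_ne (by omega)]
    simp
  · simp

theorem transv_X_pow_right {n : ℕ} {g : MvPolynomial (Fin 2) ℂ} (hg : g.IsHomogeneous n)
    (c : ℂ) : transv n n n g (C c * X 0 ^ n) = C ((-1) ^ n * c * eval ![0, 1] g) := by
  obtain ⟨a, rfl⟩ := exists_eq_binForm hg
  have h := transv_binForm_X_pow 0 n a c
  rw [zero_add] at h
  rw [h, binForm_zero, eval_zero_one_binForm, smul_eq_C_mul, ← C_mul, zero_add]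

theorem transv_X_pow_left {n : ℕ} {g : MvPolynomial (Fin 2) ℂ} (hg : g.IsHomogeneous n)
    (c : ℂ) : transv n n n (C c * X 0 ^ n) g = C (c * eval ![0, 1] g) := by
  obtain ⟨b, rfl⟩ := exists_eq_binForm hg
  have h := transv_binForm 0 0 n (Pi.single 0 c) b
  rw [zero_add] at h
  rw [C_mul_X_pow_eq_binForm, h, Finset.sum_eq_single 0]
  · simp [binForm_zero, eval_zero_one_binForm]
  · intro i _ hi
    rw [binForm_zero, Pi.single_eq_of_ne (by omega)]
    simp
  · simp

theorem X_pow_dvd_binForm (n r : ℕ) (a : ℕ → ℂ) (ha : ∀ i ≤ n, n < i + r → a i = 0) :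
    X 0 ^ r ∣ binForm n a := by
  refine Finset.dvd_sum fun i hi => ?_
  have hi' := Finset.mem_range.1 hi
  by_cases h : n < i + r
  · simp [ha i (by omega) h]
  · exact ((pow_dvd_pow _ (by omega)).mul_left _).mul_right _

/-- If `m` is a sextic with vanishing `(m,m)₆` such that the `y`-leading coefficients of
`m²`, `(m,m)₂` and `(m,m)₄` vanish, then its last four coefficients vanish. -/
theorem sextic_coeff_eq_zero (b : ℕ → ℂ) (h12 : eval ![0, 1] (binForm 6 b ^ 2) = 0)
    (h10 : eval ![0, 1] (transv 6 6 2 (binForm 6 b) (binForm 6 b)) = 0)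
    (h8 : eval ![0, 1] (transv 6 6 4 (binForm 6 b) (binForm 6 b)) = 0)
    (h6 : eval ![0, 1] (transv 6 6 6 (binForm 6 b) (binForm 6 b)) = 0) :
    b 6 = 0 ∧ b 5 = 0 ∧ b 4 = 0 ∧ b 3 = 0 := by
  rw [transv_binForm 4 4 2] at h10
  rw [transv_binForm 2 2 4] at h8
  rw [transv_binForm 0 0 6] at h6
  simp only [map_pow, eval_zero_one_binForm, map_add, smul_eval, map_mul,
   
    Finset.sum_range_succ, Finset.sum_range_zero] at h12 h10 h8 h6
  norm_num [Nat.choose] at h12 h10 h8 h6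
  have b6 : b 6 = 0 := h12
  rw [b6] at h10 h8 h6
  have b5 : b 5 = 0 := by
    refine pow_eq_zero_iff (n := 2) (by norm_num) |>.1 ?_
    linear_combination -h10 / 2
  rw [b5] at h8 h6
  have b4 : b 4 = 0 := by
    refine pow_eq_zero_iff (n := 2) (by norm_num) |>.1 ?_
    linear_combination h8 / 6
  rw [b4] at h6
  have b3 : b 3 = 0 := by
    refine pow_eq_zero_iff (n := 2) (by norm_num) |>.1 ?_
    linear_combination -h6 / 20
  exact ⟨b6, b5, b4, b3⟩

theorem decimic_coeff_eq_zero (a : ℕ → ℂ) (c : ℂ) (hk : covK (binForm 10 a) = C c * X 0 ^ 4)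
    (h10 : a 10 = 0) (h9 : a 9 = 0) (h8 : a 8 = 0) (h7 : a 7 = 0) : a 6 = 0 ∧ a 5 = 0 := by
  rw [covK, transv_binForm 2 2 8] at hk
  have key : ∀ s : ℂ, 70 * (a 4 * s ^ 2 + 2 * a 5 * s + a 6) ^ 2
      - 112 * (a 3 * s ^ 2 + 2 * a 4 * s + a 5) * (a 5 * s ^ 2 + 2 * a 6 * s)
      + 56 * (a 2 * s ^ 2 + 2 * a 3 * s + a 4) * (a 6 * s ^ 2) = c * s ^ 4 := by
    intro s
    have h := congrArg (eval ![s, 1]) hk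
    simp only [eval_binForm, map_add, smul_eval, map_mul,
      Finset.sum_range_succ, Finset.sum_range_zero] at h
    norm_num [Nat.choose, h10, h9, h8, h7] at h
    linear_combination h
  have a6 : a 6 = 0 := by
    refine pow_eq_zero_iff (n := 2) (by norm_num) |>.1 ?_
    linear_combination key 0 / 70
  simp only [a6] at key
  refine ⟨a6, pow_eq_zero_iff (n := 2) (by norm_num) |>.1 ?_⟩
  linear_combination (16 * (key 1 + key (-1)) - key 2 - key (-2)) / (24 * 168)

/-- Let `f ∈ V₁₀`, `k = (f,f)₈ ∈ V₄`. If `k` is a nonzero scalar multiple of `x⁴` and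
the invariants `A₆, j₈, j₁₀, A₁₂` all vanish at `f`, then `x⁶` divides `f`; in
particular `f` has a root of multiplicity at least 6. -/
theorem case_k_x4_invariants (f : MvPolynomial (Fin 2) ℂ) (hf : f.IsHomogeneous 10)
    (c : ℂ) (hc : c ≠ 0) (hk : covK f = C c * X 0 ^ 4)
    (hA6 : A6 f = 0) (hj8 : j8 f = 0) (hj10 : j10 f = 0) (hA12 : A12 f = 0) :
    X 0 ^ 6 ∣ f ∧ HasRootOfMult 6 f := by
  obtain ⟨a, rfl⟩ := exists_eq_binForm hf
  have hm : covM (binForm 10 a) = binForm 6 (fun j => c * a (j + 4)) := by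
    rw [covM, hk, transv_binForm_X_pow 6 4, binForm, binForm, Finset.smul_sum]
    refine Finset.sum_congr rfl fun i _ => ?_
    simp [smul_eq_C_mul]
    ring
  rw [A6, hm] at hA6
  rw [j8, covKm, hk, hm,
    transv_X_pow_left (isHomogeneous_transv_binForm 2 2 4 _ _)] at hj8
  rw [j10, hk, hm, mul_pow, ← pow_mul, ← C_pow,
    transv_X_pow_right (isHomogeneous_transv_binForm 4 4 2 _ _)] at hj10
  rw [A12, hk, hm, mul_pow, ← pow_mul, ← C_pow,
    transv_X_pow_right ((isHomogeneous_binForm 6 _).pow 2)] at hA12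
  simp only [C_eq_zero, mul_eq_zero, Nat.reduceAdd, hc, pow_eq_zero_iff, ne_eq,
    neg_eq_zero, one_ne_zero, OfNat.ofNat_ne_zero, not_false_eq_true, false_or] at hj8 hj10 hA12
  obtain ⟨h10, h9, h8, h7⟩ :=
    sextic_coeff_eq_zero _ hA12 hj10 hj8 (by rw [hA6, map_zero])
  simp only [mul_eq_zero, hc, false_or, Nat.reduceAdd] at h10 h9 h8 h7
  obtain ⟨h6, h5⟩ := decimic_coeff_eq_zero a c hk h10 h9 h8 h7
  have hdvd : X 0 ^ 6 ∣ binForm 10 a := by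
    refine X_pow_dvd_binForm 10 6 a fun i hi hi' => ?_
    have hi'' : 5 ≤ i := by omega
    interval_cases i <;> assumption
  exact ⟨hdvd, 1, 0, Or.inl one_ne_zero, by simpa using hdvd⟩
end
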